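/- Let (R,M) be a two-dimensional regular local ring with algebraically closed residue field, let I be a simple complete M-primary ideal with unique Rees valuation w, and let (R,M) < (R_1,M_1) < ... < (R_s,M_s) be the unique quadratic sequence determined by I, so that the successive transforms satisfy I^{R_s} = M_s and w is the ord_{R_s}-valuation. Then the degree function coefficients satisfy d(I,w) = d(I^{R_1},w) = ... = d(I^{R_s},w) = d(M_s, ord_{R_s}). -/

import Mathlib

open IsLocalRing

set_option synthInstance.maxHeartbeats 1000000
set_option maxHeartbeats 1000000

def Ideal.IsIntegralElemOver {R : Type*} [CommRing R] (I : Ideal R) (x : R) : Prop :=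
  ∃ n : ℕ, 0 < n ∧ ∃ c : ℕ → R, (∀ i ∈ Finset.Icc 1 n, c i ∈ I ^ i) ∧
    x ^ n + ∑ i ∈ Finset.Icc 1 n, c i * x ^ (n - i) = 0

def Ideal.IsComplete {R : Type*} [CommRing R] (I : Ideal R) : Prop :=
  ∀ x : R, I.IsIntegralElemOver x → x ∈ I

def Ideal.IsSimpleIdeal {R : Type*} [CommRing R] (I : Ideal R) : Prop :=
  I ≠ ⊤ ∧ ∀ J K : Ideal R, I = J * K → J = ⊤ ∨ K = ⊤

def Ideal.IsMPrimary {R : Type*} [CommRing R] [IsLocalRing R] (I : Ideal R) : Prop :=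
  I.radical = maximalIdeal R

/-- The ideal of nonunits of a ring; for a local ring this is its maximal ideal. -/
def maxIdealOf (S : Type*) [CommRing S] : Ideal S :=
  Ideal.span {z : S | ¬ IsUnit z}

/-- A discrete (rank one) valuation on `S`, recorded through its values in `ℕ∞` on
elements of `S`. -/
structure DiscreteValuationOn (S : Type*) [CommRing S] where
  v : S → ℕ∞
  v_zero : v 0 = ⊤
  v_one : v 1 = 0
  v_mul : ∀ x y, v (x * y) = v x + v y
  v_add : ∀ x y, min (v x) (v y) ≤ v (x + y)
  v_top_iff : ∀ x, v x = ⊤ ↔ x = 0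
  v_nontrivial : ∃ x, v x ≠ 0 ∧ v x ≠ ⊤

/-- The value `w(I)` of a valuation on an ideal: the minimum of `w` over `I`. -/
noncomputable def valIdeal {S : Type*} [CommRing S] (w : DiscreteValuationOn S)
    (I : Ideal S) : ℕ∞ :=
  ⨅ x ∈ I, w.v x

/-- `T` is the set of Rees valuations of `I`. -/
def IsReesValuationsOf {S : Type*} [CommRing S] (I : Ideal S)
    (T : Set (DiscreteValuationOn S)) : Prop :=
  T.Finite ∧
  (∀ (m : ℕ) (x : S), (I ^ m).IsIntegralElemOver x ↔
      ∀ w ∈ T, (m : ℕ∞) * valIdeal w I ≤ w.v x) ∧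
  ∀ T' ⊂ T, ¬ (∀ (m : ℕ) (x : S), (I ^ m).IsIntegralElemOver x ↔
      ∀ w ∈ T', (m : ℕ∞) * valIdeal w I ≤ w.v x)

/-- The length of a module: the supremum of the lengths of strictly increasing chains of
submodules. -/
noncomputable def moduleLength (R M : Type*) [CommRing R] [AddCommGroup M] [Module R M] : ℕ∞ :=
  ⨆ (n : ℕ) (_ : ∃ c : Fin (n + 1) → Submodule R M, StrictMono c), (n : ℕ∞)

/-- The Hilbert–Samuel length function `n ↦ length (S / J ^ n)`. -/
noncomputable def hsLength {S : Type*} [CommRing S] (J : Ideal S) (n : ℕ) : ℕ∞ :=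
  moduleLength S (S ⧸ J ^ n)

/-- `J` has (Hilbert–Samuel) multiplicity `e` in a one-dimensional ring:
eventually `length (S / J ^ n) = e * n + const`. -/
def HasMultiplicity₁ {S : Type*} [CommRing S] (J : Ideal S) (e : ℕ∞) : Prop :=
  ∃ a b : ℕ, ∀ᶠ n : ℕ in Filter.atTop, hsLength J n + a = e * n + b

/-- `d` is the degree function coefficient `d(J, w)` of an ideal `J` of the local ring `S`
whose unique Rees valuation is `w`: for every nonzero nonunit `x`, the degree function
value `d_J(x) = e((J + xS)/xS)` equals `d ⬝ w(x)`. -/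
def IsDegreeCoeffFor {S : Type*} [CommRing S] (J : Ideal S)
    (w : DiscreteValuationOn S) (d : ℕ) : Prop :=
  ∀ x ∈ maxIdealOf S, x ≠ 0 →
    HasMultiplicity₁ (Ideal.map (Ideal.Quotient.mk (Ideal.span {x})) J) ((d : ℕ∞) * w.v x)

/-- The affine chart `S[m_S/x]` of the blow-up of the maximal ideal of the local ring `S`,
inside the ambient fraction field of `R`. -/
noncomputable def chartOf {R : Type*} [CommRing R] [IsDomain R]
    (S : Subalgebra R (FractionRing R)) (x : ↥S) : Subalgebra R (FractionRing R) :=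
  Algebra.adjoin R ((S : Set (FractionRing R)) ∪
    {z | ∃ y : ↥S, y ∈ maxIdealOf ↥S ∧ z * (x : FractionRing R) = (y : FractionRing R)})

/-- `(S', J')` is obtained from `(S, J)` by the quadratic transformation determined by `J`:
for some `x` with `x V = m_S V` at the Rees valuations, `S'` is the localization of the
chart `S[m_S/x]` at the unique maximal ideal `M₁` containing the transform
`J^c = x^{-ord_S J} ⬝ J S[m_S/x]` of `J`, and `J' = J^c S'` is the transform of `J` in `S'`. -/
def IsQuadraticTransformStep {R : Type*} [CommRing R] [IsDomain R]
    (S S' : Subalgebra R (FractionRing R)) (J : Ideal ↥S) (J' : Ideal ↥S') : Prop :=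
  ∃ (x : ↥S) (r : ℕ) (hSc : S ≤ chartOf S x) (hcS' : chartOf S x ≤ S'),
    x ∈ maxIdealOf ↥S ∧
    J ≤ maxIdealOf ↥S ^ r ∧ ¬ J ≤ maxIdealOf ↥S ^ (r + 1) ∧
    ∃ M₁ : Ideal ↥(chartOf S x), M₁.IsMaximal ∧
      (Ideal.map (Subalgebra.inclusion hSc) J).colon
          (Ideal.span {Subalgebra.inclusion hSc x ^ r}) ≤ M₁ ∧
      (∀ M' : Ideal ↥(chartOf S x), M'.IsMaximal →
        (Ideal.map (Subalgebra.inclusion hSc) J).colon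
            (Ideal.span {Subalgebra.inclusion hSc x ^ r}) ≤ M' → M' = M₁) ∧
      (S' : Set (FractionRing R)) =
        {z | ∃ a b : ↥(chartOf S x), b ∉ M₁ ∧
          z * (b : FractionRing R) = (a : FractionRing R)} ∧
      J' = Ideal.map (Subalgebra.inclusion hcS')
        ((Ideal.map (Subalgebra.inclusion hSc) J).colon
          (Ideal.span {Subalgebra.inclusion hSc x ^ r}))

namespace DegAux

lemma maxIdealOf_eq (S : Type*) [CommRing S] [IsLocalRing S] :
    maxIdealOf S = maximalIdeal S := by
  apply le_antisymm
  · refine Ideal.span_le.2 fun z hz => ?_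
    exact (mem_maximalIdeal z).2 hz
  · intro z hz
    exact Ideal.subset_span ((mem_maximalIdeal z).1 hz)

lemma moduleLength_eq (R M : Type*) [CommRing R] [AddCommGroup M] [Module R M] :
    moduleLength R M = Module.length R M := by
  apply le_antisymm
  · refine iSup₂_le fun n hn => ?_
    obtain ⟨c, hc⟩ := hn
    have h : ((n : ℕ∞) : WithBot ℕ∞) ≤ Module.length R M := by
      rw [Module.coe_length]
      exact Order.LTSeries.length_le_krullDim (LTSeries.mk n c hc)
    exact_mod_cast h
  · have h : (Module.length R M : WithBot ℕ∞) ≤ (moduleLength R M : WithBot ℕ∞) := by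
      rw [Module.coe_length]
      refine iSup_le fun p => ?_
      have : (p.length : ℕ∞) ≤ moduleLength R M :=
        le_iSup₂_of_le p.length ⟨p.toFun, p.strictMono⟩ le_rfl
      exact_mod_cast this
    exact_mod_cast h

/-- `z` is a nonzerodivisor modulo `u` -/
lemma nzd {Q : Type*} [CommRing Q] [IsLocalRing Q] [IsNoetherianRing Q] (z : Q)
    (hm : maximalIdeal Q = Ideal.span {z}) (hz : ∀ n, z ^ n ≠ 0) :
    z ∈ nonZeroDivisors Q := by
  rw [mem_nonZeroDivisors_iff_right]
  intro a ha
  by_contra hne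
  have key : ∀ n : ℕ, a ∈ maximalIdeal Q ^ n := by
    intro n
    induction n with
    | zero => simp
    | succ n ih =>
      rw [hm, Ideal.span_singleton_pow, Ideal.mem_span_singleton] at ih ⊢
      obtain ⟨c, rfl⟩ := ih
      by_cases hc : IsUnit c
      · exfalso
        apply hz (n + 1)
        obtain ⟨c, rfl⟩ := hc
        have : z ^ n * ↑c * z * ↑c⁻¹ = 0 := by rw [ha, zero_mul]
        calc z ^ (n + 1) = z ^ n * ↑c * z * ↑c⁻¹ := by
              rw [pow_succ, mul_right_comm (z ^ n), Units.mul_inv_cancel_right]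
          _ = 0 := this
      · have hc : c ∈ maximalIdeal Q := (mem_maximalIdeal c).2 hc
        rw [hm, Ideal.mem_span_singleton] at hc
        rw [pow_succ]
        exact mul_dvd_mul_left _ hc
  have h0 : a ∈ ⨅ n : ℕ, maximalIdeal Q ^ n := by simpa [Ideal.mem_iInf] using key
  rw [Ideal.iInf_pow_eq_bot_of_isLocalRing _ (Ideal.IsPrime.ne_top')] at h0
  exact hne (by simpa using h0)

lemma length_pow {Q : Type*} [CommRing Q] [IsLocalRing Q] [IsNoetherianRing Q] (z : Q)
    (hm : maximalIdeal Q = Ideal.span {z}) (hz : ∀ n, z ^ n ≠ 0) (n : ℕ) :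
    Module.length Q (Q ⧸ Ideal.span {z ^ n}) = n := by
  have h1 : Ring.ord Q z = 1 := by
    rw [Ring.ord, Module.length_eq_one_iff, isSimpleModule_iff_isCoatom, ← hm]
    exact Ideal.isMaximal_def.1 inferInstance
  have := Ring.ord_pow (nzd z hm hz) n
  rw [h1, Ring.ord] at this
  simpa using this

lemma mult_eq {Q : Type*} [CommRing Q] [IsLocalRing Q] [IsNoetherianRing Q] (z : Q)
    (hm : maximalIdeal Q = Ideal.span {z}) (hz : ∀ n, z ^ n ≠ 0) (q e : ℕ)
    (h : HasMultiplicity₁ (Ideal.span {z ^ q}) (e : ℕ∞)) : q = e := by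
  obtain ⟨a, b, h⟩ := h
  obtain ⟨N, hN⟩ := Filter.eventually_atTop.1 h
  have key : ∀ n ≥ N, q * n + a = e * n + b := by
    intro n hn
    have := hN n hn
    rw [hsLength, moduleLength_eq, Ideal.span_singleton_pow, ← pow_mul, length_pow z hm hz] at this
    exact_mod_cast this
  have k1 := key N le_rfl
  have k2 := key (N + 1) (by omega)
  rw [mul_add, mul_add] at k2
  omega

lemma not_pow_mem {S : Type*} [CommRing S] [IsLocalRing S] [IsNoetherianRing S]
    (hdim : ringKrullDim S = 2) (u z : S) (hm : maximalIdeal S = Ideal.span {u, z}) (n : ℕ) :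
    z ^ n ∉ Ideal.span {u} := by
  intro h
  have hmin : maximalIdeal S ∈ (Ideal.span {u}).minimalPrimes := by
    refine ⟨⟨inferInstance, ?_⟩, ?_⟩
    · rw [hm]; exact Ideal.span_mono (by simp)
    · rintro p ⟨hp, hup⟩ -
      rw [hm, Ideal.span_le]
      rintro x (rfl | rfl)
      · exact hup (Ideal.subset_span rfl)
      · exact hp.mem_of_pow_mem n (hup h)
  have h1 := Ideal.height_le_one_of_isPrincipal_of_mem_minimalPrimes _ _ hmin
  have h2 := IsLocalRing.maximalIdeal_height_eq_ringKrullDim (R := S)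
  rw [hdim] at h2
  have h3 : (maximalIdeal S).height = 2 := by
    have h4 : ((maximalIdeal S).height : WithBot ℕ∞) = ((2 : ℕ∞) : WithBot ℕ∞) := h2
    exact WithBot.coe_injective h4
  rw [h3] at h1
  exact absurd h1 (by decide)

/-- structure of `S / u` -/
lemma quot_struct {S : Type*} [CommRing S] [IsLocalRing S] [IsNoetherianRing S]
    (hdim : ringKrullDim S = 2) (u z : S) (hm : maximalIdeal S = Ideal.span {u, z}) :
    ∃ _ : IsLocalRing (S ⧸ Ideal.span {u}),
      maximalIdeal (S ⧸ Ideal.span {u}) = Ideal.span {Ideal.Quotient.mk (Ideal.span {u}) z} ∧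
      ∀ n, (Ideal.Quotient.mk (Ideal.span {u}) z) ^ n ≠ 0 := by
  have hz : ∀ n, (Ideal.Quotient.mk (Ideal.span {u}) z) ^ n ≠ 0 := by
    intro n h
    rw [← map_pow, Ideal.Quotient.eq_zero_iff_mem] at h
    exact not_pow_mem hdim u z hm n h
  have : Nontrivial (S ⧸ Ideal.span {u}) := ⟨⟨_, 0, hz 0⟩⟩
  have hl : IsLocalRing (S ⧸ Ideal.span {u}) :=
    IsLocalRing.of_surjective' _ Ideal.Quotient.mk_surjective
  refine ⟨hl, ?_, hz⟩
  have h1 : (maximalIdeal S).map (Ideal.Quotient.mk (Ideal.span {u})) =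
      maximalIdeal (S ⧸ Ideal.span {u}) :=
    IsLocalRing.map_maximalIdeal_of_surjective _ Ideal.Quotient.mk_surjective
  rw [← h1, hm, Ideal.map_span, Set.image_pair]
  have : Ideal.Quotient.mk (Ideal.span {u}) u = 0 :=
    Ideal.Quotient.eq_zero_iff_mem.2 (Ideal.subset_span rfl)
  rw [this]
  simp

lemma val_ne_top {S : Type*} [CommRing S] (w : DiscreteValuationOn S) {x : S} (hx : x ≠ 0) :
    w.v x ≠ ⊤ := fun h => hx ((w.v_top_iff x).1 h)

/-- degree coefficients via a smooth curve. -/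
lemma deg_smooth {S : Type*} [CommRing S] [IsLocalRing S] [IsNoetherianRing S]
    (hdim : ringKrullDim S = 2) (u z : S) (hm : maximalIdeal S = Ideal.span {u, z})
    (J : Ideal S) (w : DiscreteValuationOn S) (d : ℕ) (hd : IsDegreeCoeffFor J w d)
    (q : ℕ) (h1 : J ≤ Ideal.span {u, z ^ q}) (h2 : ∃ f ∈ J, z ^ q - f ∈ Ideal.span {u}) :
    u ≠ 0 ∧ (q : ℕ∞) = d * w.v u := by
  have hm' : maximalIdeal S = Ideal.span {z, u} := by rw [hm, Set.pair_comm]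
  have hu : u ≠ 0 := by
    intro h
    exact not_pow_mem hdim z u hm' 1 (by simp [h])
  refine ⟨hu, ?_⟩
  obtain ⟨_, hQ, hnil⟩ := quot_struct hdim u z hm
  have := hd u (by rw [maxIdealOf_eq, hm]; exact Ideal.subset_span (by simp)) hu
  have hJ : J.map (Ideal.Quotient.mk (Ideal.span {u})) =
      Ideal.span {(Ideal.Quotient.mk (Ideal.span {u}) z) ^ q} := by
    have h0 : Ideal.Quotient.mk (Ideal.span {u}) u = 0 :=
      Ideal.Quotient.eq_zero_iff_mem.2 (Ideal.subset_span rfl)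
    apply le_antisymm
    · refine (Ideal.map_mono h1).trans ?_
      rw [Ideal.map_span, Set.image_pair, h0, map_pow]
      simp
    · rw [Ideal.span_singleton_le_iff_mem]
      obtain ⟨f, hf, hfz⟩ := h2
      rw [← map_pow, Ideal.Quotient.eq.2 hfz]
      exact Ideal.mem_map_of_mem _ hf
  rw [hJ] at this
  obtain ⟨k, hk⟩ := ENat.ne_top_iff_exists.1 (val_ne_top w hu)
  rw [← hk] at this ⊢
  have h3 := mult_eq _ hQ hnil q (d * k) (by exact_mod_cast this)
  rw [h3]; push_cast; rfl

lemma pow_mem_of_deg {S : Type*} [CommRing S] [IsLocalRing S]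
    (J : Ideal S) (w : DiscreteValuationOn S) (d : ℕ) (hd : IsDegreeCoeffFor J w d)
    (hbot : J ≠ ⊥) (x : S) (hx : x ∈ maximalIdeal S) : ∃ N, x ^ N ∈ J := by
  by_cases htop : J = ⊤
  · exact ⟨0, by simp [htop]⟩
  obtain ⟨f, hf, hf0⟩ := Submodule.exists_mem_ne_zero_of_ne_bot hbot
  have hfm : f ∈ maxIdealOf S := by
    rw [maxIdealOf_eq]; exact le_maximalIdeal htop hf
  obtain ⟨a, b, h⟩ := hd f hfm hf0
  obtain ⟨N, hN⟩ := Filter.eventually_atTop.1 h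
  have := hN (N + 1) (by omega)
  rw [hsLength, moduleLength_eq] at this
  obtain ⟨k, hk⟩ := ENat.ne_top_iff_exists.1 (val_ne_top w hf0)
  rw [← hk] at this
  set Q := S ⧸ Ideal.span {f}
  set K := (J.map (Ideal.Quotient.mk (Ideal.span {f}))) ^ (N + 1) with hK
  have hfin : Module.length Q (Q ⧸ K) ≠ ⊤ := by
    intro h
    rw [h, top_add] at this
    have h2 : (⊤ : ℕ∞) = ((d * k * (N + 1) + b : ℕ) : ℕ∞) := by
      rw [this]; push_cast; rfl
    exact ENat.natCast_ne_top _ h2.symm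
  have hfl := Module.length_ne_top_iff.1 hfin
  rw [isFiniteLength_iff_isNoetherian_isArtinian] at hfl
  have := hfl.2
  obtain ⟨n, hn⟩ := IsArtinian.range_smul_pow_stabilizes (Q ⧸ K) (Ideal.Quotient.mk (Ideal.span {f}) x)
  have h1 := hn (n + 1) (by omega)
  have h2 : (Ideal.Quotient.mk (Ideal.span {f}) x) ^ n • (1 : Q ⧸ K) ∈ LinearMap.range
    (((Ideal.Quotient.mk (Ideal.span {f}) x) ^ n) • (LinearMap.id : Q ⧸ K →ₗ[Q] Q ⧸ K)) := ⟨1, rfl⟩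
  rw [h1] at h2
  obtain ⟨c, hc⟩ := h2
  obtain ⟨c, rfl⟩ := Ideal.Quotient.mk_surjective c
  obtain ⟨c, rfl⟩ := Ideal.Quotient.mk_surjective c
  refine ⟨n, ?_⟩
  have h3 : Ideal.Quotient.mk K (Ideal.Quotient.mk (Ideal.span {f}) (x ^ (n+1) * c)) =
      Ideal.Quotient.mk K (Ideal.Quotient.mk (Ideal.span {f}) (x ^ n)) := by
    have hc' := hc
    rw [LinearMap.smul_apply, LinearMap.id_apply, Algebra.smul_def, Algebra.smul_def, mul_one] at hc'
    have e : ∀ k, Ideal.Quotient.mk (Ideal.span {f}) (x ^ k) =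
        Ideal.Quotient.mk (Ideal.span {f}) x ^ k := fun k => map_pow _ _ _
    rw [map_mul, map_mul, e, e]
    exact hc'
  rw [Ideal.Quotient.eq, ← map_sub] at h3
  have h4 := (Ideal.pow_le_self (by omega) : K ≤ _) h3
  rw [Ideal.mem_map_iff_of_surjective _ Ideal.Quotient.mk_surjective] at h4
  obtain ⟨g, hg, hge⟩ := h4
  have h5 : g - (x ^ (n+1) * c - x ^ n) ∈ J :=
    (Ideal.span_singleton_le_iff_mem J).2 hf (Ideal.Quotient.eq.1 hge)
  have h6 : x ^ n * (1 - x * c) ∈ J := by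
    have := J.sub_mem h5 hg
    convert this using 1; ring
  have hu : IsUnit (1 - x * c) := by
    have : x * c ∈ maximalIdeal S := Ideal.mul_mem_right _ _ hx
    exact isUnit_one_sub_self_of_mem_nonunits _ this
  exact (Ideal.mul_unit_mem_iff_mem J hu).1 h6

lemma mem_pow_repr {S : Type*} [CommRing S] (t z : S) (r : ℕ) (f : S)
    (hf : f ∈ Ideal.span {t, z} ^ r) :
    ∃ a : ℕ → S, f = ∑ j ∈ Finset.range (r + 1), a j * t ^ j * z ^ (r - j) := by
  induction r generalizing f with
  | zero => exact ⟨fun _ => f, by simp⟩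
  | succ r ih =>
    rw [pow_succ'] at hf
    refine Submodule.mul_induction_on hf ?_ ?_
    · intro m hm n hn
      obtain ⟨x, y, rfl⟩ := Ideal.mem_span_pair.1 hm
      obtain ⟨a, rfl⟩ := ih n hn
      refine ⟨fun j => (if j = 0 then 0 else x * a (j - 1)) + (if j = r + 1 then 0 else y * a j), ?_⟩
      simp only [add_mul, Finset.sum_add_distrib]
      congr 1
      · rw [Finset.sum_range_succ' _ (r + 1)]
        simp only [if_true, zero_mul, add_zero, Finset.mul_sum]
        refine Finset.sum_congr rfl fun j _ => ?_
        simp only [Nat.add_eq_zero_iff, one_ne_zero, and_false, if_false, Nat.add_sub_cancel,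
          Nat.reduceSubDiff]
        ring
      · rw [Finset.sum_range_succ _ (r + 1)]
        simp only [if_true, zero_mul, add_zero, Finset.mul_sum]
        refine Finset.sum_congr rfl fun j hj => ?_
        have hj := Finset.mem_range.1 hj
        rw [if_neg (by omega), show r + 1 - j = (r - j) + 1 by omega]
        ring
    · rintro x y ⟨a, rfl⟩ ⟨b, rfl⟩
      exact ⟨a + b, by simp [add_mul, Finset.sum_add_distrib]⟩

lemma val_unit {S : Type*} [CommRing S] (w : DiscreteValuationOn S) {x : S} (hx : IsUnit x) :
    w.v x = 0 := by
  obtain ⟨y, hy⟩ := hx.exists_right_inv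
  have := w.v_mul x y
  rw [hy, w.v_one] at this
  exact (add_eq_zero.1 this.symm).1

lemma exists_generic {S : Type*} [CommRing S] [IsLocalRing S] [Infinite (ResidueField S)]
    (r : ℕ) (a : ℕ → S) (h : ∃ j ∈ Finset.range (r + 1), a j ∉ maximalIdeal S) :
    ∃ c : S, IsUnit (∑ j ∈ Finset.range (r + 1), a j * c ^ j) := by
  classical
  set p : Polynomial (ResidueField S) :=
    ∑ j ∈ Finset.range (r + 1), Polynomial.C (residue S (a j)) * Polynomial.X ^ j with hp
  have hp0 : p ≠ 0 := by
    obtain ⟨j, hj, hja⟩ := h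
    intro h0
    apply hja
    have : p.coeff j = residue S (a j) := by
      rw [hp, Polynomial.finsetSum_coeff]
      simp only [Polynomial.coeff_C_mul, Polynomial.coeff_X_pow, mul_ite, mul_one, mul_zero]
      rw [Finset.sum_ite_eq, if_pos hj]
    rw [h0, Polynomial.coeff_zero] at this
    exact (residue_eq_zero_iff _).1 this.symm
  have : ∃ x, p.eval x ≠ 0 := by
    by_contra! hall
    exact hp0 (Polynomial.funext (by simpa using hall))
  obtain ⟨x, hx⟩ := this
  obtain ⟨c, rfl⟩ := residue_surjective x
  refine ⟨c, ?_⟩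
  by_contra hu
  apply hx
  have h2 := (residue_eq_zero_iff _).2 ((mem_maximalIdeal _).2 hu)
  rw [hp, Polynomial.eval_finsetSum]
  simpa using h2

lemma exists_exponent {S : Type*} [CommRing S] [IsLocalRing S]
    (u z : S) (hm : maximalIdeal S = Ideal.span {u, z})
    (J : Ideal S) (N : ℕ) (hN : z ^ N ∈ J) :
    ∃ q, J ≤ Ideal.span {u, z ^ q} ∧ ∃ f ∈ J, z ^ q - f ∈ Ideal.span {u} := by
  classical
  have hex : ∃ q, ∃ f ∈ J, z ^ q - f ∈ Ideal.span {u} := ⟨N, z ^ N, hN, by simp⟩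
  refine ⟨Nat.find hex, ?_, Nat.find_spec hex⟩
  intro x hx
  have key : ∀ j ≤ Nat.find hex, x ∈ Ideal.span {u, z ^ j} := by
    intro j
    induction j with
    | zero => intro _; rw [Ideal.mem_span_pair]; exact ⟨0, x, by simp⟩
    | succ j ih =>
      intro hj
      obtain ⟨a, c, hac⟩ := Ideal.mem_span_pair.1 (ih (by omega))
      by_cases hc : IsUnit c
      · exfalso
        apply Nat.find_min hex (m := j) (by omega)
        obtain ⟨c, rfl⟩ := hc
        refine ⟨↑c⁻¹ * x, J.mul_mem_left _ hx, ?_⟩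
        rw [Ideal.mem_span_singleton]
        refine ⟨- (↑c⁻¹ * a), ?_⟩
        rw [← hac, mul_add, Units.inv_mul_cancel_left]
        ring
      · have : c ∈ maximalIdeal S := (mem_maximalIdeal c).2 hc
        rw [hm] at this
        obtain ⟨e, g, rfl⟩ := Ideal.mem_span_pair.1 this
        rw [Ideal.mem_span_pair]
        exact ⟨a + e * z ^ j, g, by rw [← hac]; ring⟩
  exact key _ le_rfl

lemma cancel_pow {S : Type*} [CommRing S] [IsLocalRing S] [IsNoetherianRing S]
    (hdim : ringKrullDim S = 2) (u z : S) (hm : maximalIdeal S = Ideal.span {u, z})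
    (a : S) (r : ℕ) (h : z ^ r * a ∈ Ideal.span {u}) : a ∈ Ideal.span {u} := by
  obtain ⟨_, hQ, hnil⟩ := quot_struct hdim u z hm
  have h1 := nzd _ hQ hnil
  have h2 := pow_mem h1 r
  rw [← Ideal.Quotient.eq_zero_iff_mem] at h ⊢
  rw [map_mul, map_pow] at h
  exact (mem_nonZeroDivisors_iff.1 h2).1 _ h

theorem core {S S' : Type*} [CommRing S] [IsLocalRing S] [IsNoetherianRing S]
    [CommRing S'] [IsLocalRing S'] [IsNoetherianRing S'] [IsDomain S']
    [Infinite (ResidueField S)]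
    (hdim : ringKrullDim S = 2) (hdim' : ringKrullDim S' = 2)
    (φ : S →+* S') (t z : S) (z' : S')
    (hm : maximalIdeal S = Ideal.span {t, z})
    (hm' : maximalIdeal S' = Ideal.span {φ t, z'})
    (hz : φ z = φ t * z')
    (J : Ideal S) (J' : Ideal S') (r : ℕ) (hr : J ≤ maximalIdeal S ^ r)
    (hr' : ¬ J ≤ maximalIdeal S ^ (r + 1))
    (hJ' : J' = Ideal.span {g | ∃ f ∈ J, g * φ t ^ r = φ f})
    (hbot : J ≠ ⊥) (hbot' : J' ≠ ⊥) (htop' : J' ≠ ⊤)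
    (w : DiscreteValuationOn S) (w' : DiscreteValuationOn S')
    (hw : ∀ a, w'.v (φ a) = w.v a) (hRees : IsReesValuationsOf J' {w'})
    (d d' : ℕ) (hd : IsDegreeCoeffFor J w d) (hd' : IsDegreeCoeffFor J' w' d') : d = d' := by
  have hmc : maximalIdeal S = Ideal.span {z, t} := by rw [hm, Set.pair_comm]
  have hmc' : maximalIdeal S' = Ideal.span {z', φ t} := by rw [hm', Set.pair_comm]
  have hz'm : z' ∈ maximalIdeal S' := by rw [hm']; exact Ideal.subset_span (by simp)
  have htm : t ∈ maximalIdeal S := by rw [hm]; exact Ideal.subset_span (by simp)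
  have hA : (r : ℕ∞) = d * w.v t := by
    obtain ⟨f, hf, hfr⟩ := Set.not_subset.1 hr'
    have hfr0 := hr hf
    rw [hm] at hfr0
    obtain ⟨a, ha⟩ := mem_pow_repr t z r f hfr0
    have hex : ∃ j ∈ Finset.range (r + 1), a j ∉ maximalIdeal S := by
      by_contra! hall
      apply hfr
      rw [ha]
      refine Ideal.sum_mem _ fun j hj => ?_
      have hj' := Finset.mem_range.1 hj
      have h1 : t ^ j ∈ maximalIdeal S ^ j := Ideal.pow_mem_pow htm j
      have h2 : z ^ (r - j) ∈ maximalIdeal S ^ (r - j) :=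
        Ideal.pow_mem_pow (by rw [hm]; exact Ideal.subset_span (by simp)) _
      have h3 := Ideal.mul_mem_mul (Ideal.mul_mem_mul (hall j hj) h1) h2
      rw [← pow_succ', ← pow_add, show j + 1 + (r - j) = r + 1 by omega] at h3
      exact h3
    obtain ⟨c, hc⟩ := exists_generic r a hex
    have hmu : maximalIdeal S = Ideal.span {t - c * z, z} := by
      rw [hm]
      apply le_antisymm
      · rw [Ideal.span_le]
        rintro x (rfl | rfl)
        · exact Ideal.mem_span_pair.2 ⟨1, c, by ring⟩
        · exact Ideal.subset_span (by simp)
      · rw [Ideal.span_le]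
        rintro x (rfl | rfl)
        · exact Ideal.mem_span_pair.2 ⟨1, -c, by ring⟩
        · exact Ideal.subset_span (by simp)
    have hcong : ∀ b : ℕ → S, (∑ j ∈ Finset.range (r + 1), b j * t ^ j * z ^ (r - j)) -
        (∑ j ∈ Finset.range (r + 1), b j * c ^ j) * z ^ r ∈ Ideal.span {t - c * z} := by
      intro b
      rw [Finset.sum_mul, ← Finset.sum_sub_distrib]
      refine Ideal.sum_mem _ fun j hj => ?_
      have hj' := Finset.mem_range.1 hj
      have : b j * t ^ j * z ^ (r - j) - b j * c ^ j * z ^ r =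
          b j * z ^ (r - j) * (t ^ j - (c * z) ^ j) := by
        conv_lhs => rw [show z ^ r = z ^ j * z ^ (r - j) by rw [← pow_add]; congr 1; omega]
        ring
      rw [this]
      exact Ideal.mul_mem_left _ _ (Ideal.mem_span_singleton.2 (sub_dvd_pow_sub_pow _ _ _))
    have := deg_smooth hdim (t - c * z) z hmu J w d hd r ?_ ?_
    · rw [this.2, ← hw, ← hw t, map_sub, map_mul, hz,
        show φ t - φ c * (φ t * z') = φ t * (1 - φ c * z') by ring, w'.v_mul,
        val_unit w' (isUnit_one_sub_self_of_mem_nonunits _ (Ideal.mul_mem_left (maximalIdeal S') _ hz'm)), add_zero]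
    · intro g hg
      have hgr := hr hg
      rw [hm] at hgr
      obtain ⟨b, hb⟩ := mem_pow_repr t z r g hgr
      obtain ⟨e, he⟩ := Ideal.mem_span_singleton.1 (hcong b)
      rw [← hb] at he
      exact Ideal.mem_span_pair.2 ⟨e, ∑ j ∈ Finset.range (r + 1), b j * c ^ j, by
        rw [mul_comm e, ← he]; ring⟩
    · obtain ⟨c', hc'⟩ := hc.exists_left_inv
      refine ⟨c' * f, J.mul_mem_left _ hf, ?_⟩
      have := Ideal.mul_mem_left _ (-c') (hcong a)
      rw [← ha] at this
      convert this using 1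
      rw [mul_sub, neg_mul c' (_ * _), ← mul_assoc, hc']
      ring
  have hdec : ∀ f ∈ J, ∃ a : S, ∃ g : S', φ f = φ t ^ r * (φ a + z' * g) ∧
      t ^ r * a - f ∈ Ideal.span {z} := by
    intro f hf
    have hfr := hr hf
    rw [hm] at hfr
    obtain ⟨a, ha⟩ := mem_pow_repr t z r f hfr
    rw [Finset.sum_range_succ] at ha
    refine ⟨a r, ∑ j ∈ Finset.range r, φ (a j) * z' ^ (r - j - 1), ?_, ?_⟩
    · rw [ha, map_add, map_sum, mul_add, add_comm]
      congr 1
      · simp [mul_comm]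
      · rw [Finset.mul_sum, Finset.mul_sum]
        refine Finset.sum_congr rfl fun j hj => ?_
        have hj := Finset.mem_range.1 hj
        obtain ⟨k, rfl⟩ : ∃ k, r = j + k + 1 := ⟨r - j - 1, by omega⟩
        rw [show j + k + 1 - j = k + 1 by omega]
        simp only [map_mul, map_pow, hz, Nat.add_sub_cancel]
        ring
    · rw [ha]
      have : t ^ r * a r - (∑ j ∈ Finset.range r, a j * t ^ j * z ^ (r - j) +
          a r * t ^ r * z ^ (r - r)) = - ∑ j ∈ Finset.range r, a j * t ^ j * z ^ (r - j) := by
        simp; ring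
      rw [this]
      refine neg_mem (Ideal.sum_mem _ fun j hj => ?_)
      have hj := Finset.mem_range.1 hj
      exact Ideal.mul_mem_left _ _ (Ideal.mem_span_singleton.2 (dvd_pow_self _ (by omega)))
  obtain ⟨N, hN⟩ := pow_mem_of_deg J w d hd hbot t htm
  obtain ⟨q, hq1, hq2⟩ := exists_exponent z t hmc J N hN
  obtain ⟨hz0, hB⟩ := deg_smooth hdim z t hmc J w d hd q hq1 hq2
  have ht0 : φ t ≠ 0 := by
    intro h
    exact not_pow_mem hdim' z' (φ t) hmc' 1 (by simp [h])
  obtain ⟨f0, hf0, hf0q⟩ := hq2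
  have hqr : r ≤ q := by
    by_contra hlt
    obtain ⟨a, -, -, ha⟩ := hdec f0 hf0
    have h1 := sub_mem hf0q ha
    obtain ⟨k, rfl⟩ : ∃ k, r = q + (k + 1) := ⟨r - q - 1, by omega⟩
    have h2 : t ^ q * (1 - t * (t ^ k * a)) ∈ Ideal.span {z} := by
      convert h1 using 1; ring
    have hu : IsUnit (1 - t * (t ^ k * a)) := by
      have : t * (t ^ k * a) ∈ maximalIdeal S := Ideal.mul_mem_right _ _ htm
      exact isUnit_one_sub_self_of_mem_nonunits _ this
    exact not_pow_mem hdim z t hmc q ((Ideal.mul_unit_mem_iff_mem _ hu).1 h2)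
  obtain ⟨p, rfl⟩ := Nat.exists_eq_add_of_le hqr
  have hzz : ∀ x ∈ Ideal.span {z}, φ x ∈ Ideal.span {z'} := by
    intro x hx
    obtain ⟨y, rfl⟩ := Ideal.mem_span_singleton.1 hx
    rw [map_mul, hz]
    exact Ideal.mem_span_singleton.2 ⟨φ t * φ y, by ring⟩
  have hC := deg_smooth hdim' z' (φ t) hmc' J' w' d' hd' p ?_ ?_
  rotate_left
  · rw [hJ', Ideal.span_le]
    rintro g ⟨f, hf, hg⟩
    obtain ⟨a, g', h1, h2⟩ := hdec f hf
    have hg2 : g = φ a + z' * g' := by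
      have h3 : φ t ^ r * (g - (φ a + z' * g')) = 0 := by
        rw [mul_sub, ← h1, ← hg]; ring
      rcases mul_eq_zero.1 h3 with h | h
      · exact absurd h (pow_ne_zero _ ht0)
      · exact sub_eq_zero.1 h
    obtain ⟨x, y, hxy⟩ := Ideal.mem_span_pair.1 (hq1 hf)
    have h4 : t ^ r * (a - y * t ^ p) ∈ Ideal.span {z} := by
      have h5 : x * z ∈ Ideal.span {z} := Ideal.mem_span_singleton.2 ⟨x, by ring⟩
      have := add_mem h2 h5
      convert this using 1
      rw [← hxy]; ring
    have h6 := hzz _ (cancel_pow hdim z t hmc _ r h4)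
    obtain ⟨e, he⟩ := Ideal.mem_span_singleton.1 h6
    rw [map_sub, map_mul, map_pow] at he
    rw [SetLike.mem_coe, Ideal.mem_span_pair]
    refine ⟨e + g', φ y, ?_⟩
    rw [hg2]
    linear_combination -he
  · obtain ⟨a, g', h1, h2⟩ := hdec f0 hf0
    refine ⟨φ a + z' * g', ?_, ?_⟩
    · rw [hJ']
      exact Ideal.subset_span ⟨f0, hf0, by rw [h1]; ring⟩
    · have h4 : t ^ r * (t ^ p - a) ∈ Ideal.span {z} := by
        have := sub_mem hf0q h2
        convert this using 1
        ring
      have h6 := hzz _ (cancel_pow hdim z t hmc _ r h4)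
      obtain ⟨e, he⟩ := Ideal.mem_span_singleton.1 h6
      rw [map_sub, map_pow] at he
      rw [Ideal.mem_span_singleton]
      exact ⟨e - g', by linear_combination he⟩
  obtain ⟨hz'0, hC⟩ := hC
  have hpos : w'.v z' ≠ 0 := by
    intro h0
    obtain ⟨M, hM⟩ := pow_mem_of_deg J' w' d' hd' hbot' z' hz'm
    have hvp : ∀ n, w'.v (z' ^ n) = 0 := by
      intro n
      induction n with
      | zero => simp [w'.v_one]
      | succ n ih => rw [pow_succ, w'.v_mul, ih, h0, add_zero]
    have hval : valIdeal w' J' = 0 := by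
      apply le_antisymm _ bot_le
      exact (iInf₂_le _ hM).trans (hvp M).le
    have h1 := (hRees.2.1 1 1).2 (by
      intro v hv
      rw [Set.mem_singleton_iff.1 hv, hval]; simp)
    obtain ⟨n, hn, c, hc, hsum⟩ := h1
    apply htop'
    rw [Ideal.eq_top_iff_one]
    have h2 : ∑ i ∈ Finset.Icc 1 n, c i * 1 ^ (n - i) ∈ J' := by
      refine Ideal.sum_mem _ fun i hi => Ideal.mul_mem_right _ _ ?_
      have := hc i hi
      rw [pow_one] at this
      exact Ideal.pow_le_self (by have := (Finset.mem_Icc.1 hi).1; omega) this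
    rw [one_pow] at hsum
    rw [eq_neg_of_add_eq_zero_left hsum]
    exact neg_mem h2
  have hvz : w.v z = w.v t + w'.v z' := by rw [← hw, hz, w'.v_mul, hw]
  obtain ⟨k, hk⟩ := ENat.ne_top_iff_exists.1 (val_ne_top w' hz'0)
  obtain ⟨l, hl⟩ := ENat.ne_top_iff_exists.1 (by
    have := val_ne_top w' ht0
    rwa [hw] at this : w.v t ≠ ⊤)
  rw [hvz, ← hk, ← hl] at hB
  rw [← hl] at hA
  rw [← hk] at hC hpos
  have hA' : r = d * l := by exact_mod_cast hA
  have hB' : r + p = d * (l + k) := by exact_mod_cast hB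
  have hC' : p = d' * k := by exact_mod_cast hC
  have hk0 : k ≠ 0 := by exact_mod_cast hpos
  have : d * k = d' * k := by rw [mul_add] at hB'; omega
  exact Nat.eq_of_mul_eq_mul_right (Nat.pos_of_ne_zero hk0) this

lemma algClosed_transfer {S S' : Type u} [CommRing S] [IsLocalRing S] [CommRing S'] [IsLocalRing S']
    [IsAlgClosed (ResidueField S)] (φ : S →+* S')
    (h1 : ∀ x ∈ maximalIdeal S, φ x ∈ maximalIdeal S')
    (h2 : ∀ y : S', ∃ x : S, y - φ x ∈ maximalIdeal S') : IsAlgClosed (ResidueField S') := by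
  have : IsLocalHom φ := ⟨fun x hx => by
    by_contra hn
    exact h1 x ((mem_maximalIdeal x).2 hn) hx⟩
  refine IsAlgClosed.of_ringEquiv (ResidueField S) (ResidueField S')
    (RingEquiv.ofBijective (ResidueField.map φ) ⟨RingHom.injective _, ?_⟩)
  intro y
  obtain ⟨y, rfl⟩ := residue_surjective y
  obtain ⟨x, hx⟩ := h2 y
  refine ⟨residue S x, ?_⟩
  rw [ResidueField.map_residue]
  have := (residue_eq_zero_iff _).2 hx
  rw [map_sub, sub_eq_zero] at this
  exact this.symm

lemma chart_point_aux {S B K : Type*} [CommRing S] [IsLocalRing S] [CommRing B] [Field K]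
    [IsAlgClosed (ResidueField S)] (ι : S →+* B) (π : B →+* K) (hπ : Function.Surjective π)
    (hι : ∀ x ∈ maximalIdeal S, π (ι x) = 0) (y : B)
    (hgen : ∀ g : B, ∃ p : Polynomial S, g = p.eval₂ ι y) : ∃ s : S, π y = π (ι s) := by
  let f : S →+* K := π.comp ι
  have : IsLocalHom f := ⟨fun x hx => by
    by_contra hn
    have h0 : f x = 0 := hι x ((mem_maximalIdeal x).2 hn)
    rw [h0] at hx
    exact not_isUnit_zero hx⟩
  let _ : Algebra (ResidueField S) K := (ResidueField.lift f).toAlgebra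
  have hfr : ∀ s, algebraMap (ResidueField S) K (residue S s) = π (ι s) :=
    fun s => rfl
  have htop : Algebra.adjoin (ResidueField S) {π y} = ⊤ := by
    rw [eq_top_iff]
    rintro g -
    obtain ⟨g, rfl⟩ := hπ g
    obtain ⟨p, rfl⟩ := hgen g
    rw [Polynomial.eval₂_eq_sum_range, map_sum]
    refine Subalgebra.sum_mem _ fun i _ => ?_
    rw [map_mul, map_pow, ← hfr]
    exact Subalgebra.mul_mem _ (Subalgebra.algebraMap_mem _ _)
      (Subalgebra.pow_mem _ (Algebra.subset_adjoin (Set.mem_singleton _)) _)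
  have : Algebra.FiniteType (ResidueField S) K :=
    ⟨⟨{π y}, by rw [Finset.coe_singleton]; exact htop⟩⟩
  have := finite_of_finite_type_of_isJacobsonRing (ResidueField S) K
  obtain ⟨k, hk⟩ := (IsAlgClosed.algebraMap_bijective_of_isIntegral
    (k := ResidueField S) (K := K)).2 (π y)
  obtain ⟨s, rfl⟩ := residue_surjective k
  rw [hfr] at hk
  exact ⟨s, hk.symm⟩

lemma chart_point {S B : Type*} [CommRing S] [IsLocalRing S] [CommRing B]
    [IsAlgClosed (ResidueField S)] (ι : S →+* B) (M₁ : Ideal B) (hM : M₁.IsMaximal)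
    (hι : ∀ x ∈ maximalIdeal S, ι x ∈ M₁) (y : B)
    (hgen : ∀ g : B, ∃ p : Polynomial S, g = p.eval₂ ι y) : ∃ s : S, y - ι s ∈ M₁ := by
  let _ : Field (B ⧸ M₁) := Ideal.Quotient.field M₁
  obtain ⟨s, hs⟩ := chart_point_aux (K := B ⧸ M₁) ι (Ideal.Quotient.mk M₁)
    Ideal.Quotient.mk_surjective (fun x hx => Ideal.Quotient.eq_zero_iff_mem.2 (hι x hx)) y hgen
  exact ⟨s, Ideal.Quotient.eq.1 hs⟩

theorem chart_abs {S B S' : Type u} [CommRing S] [IsDomain S] [IsLocalRing S] [CommRing B] [IsDomain B]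
    [CommRing S'] [IsLocalRing S'] [IsDomain S'] [IsAlgClosed (ResidueField S)]
    (ι : S →+* B) (κ : B →+* S') (φ : S →+* S') (hφ : ∀ s, φ s = κ (ι s))
    (hιi : Function.Injective ι) (hκi : Function.Injective κ)
    (t : S) (ht0 : t ≠ 0) (M₁ : Ideal B) (hM : M₁.IsMaximal) (htM : ι t ∈ M₁)
    (htm : t ∈ maximalIdeal S)
    (hdiv : ∀ y ∈ maximalIdeal S, ∃ y' : B, y' * ι t = ι y)
    (hm2 : ∃ a b, maximalIdeal S = Ideal.span {a, b})
    (hgen : ∀ y0, maximalIdeal S = Ideal.span {t, y0} → ∀ y : B, y * ι t = ι y0 →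
      ∀ g : B, ∃ p : Polynomial S, g = p.eval₂ ι y)
    (hloc1 : ∀ b, b ∉ M₁ → IsUnit (κ b))
    (hloc2 : ∀ y : S', ∃ a b, b ∉ M₁ ∧ y * κ b = κ a)
    (J : Ideal S) (J' : Ideal S') (r : ℕ) (hJ0 : J ≠ ⊥) (hr : J ≤ maximalIdeal S ^ r)
    (C : Ideal B) (hC : ∀ c, c ∈ C ↔ c * ι t ^ r ∈ J.map ι) (hCM : C ≤ M₁) (hJ' : J' = C.map κ) :
    (∃ (z : S) (z' : S'), maximalIdeal S = Ideal.span {t, z} ∧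
      maximalIdeal S' = Ideal.span {φ t, z'} ∧ φ z = φ t * z' ∧
      J' = Ideal.span {g | ∃ f ∈ J, g * φ t ^ r = φ f}) ∧ J' ≠ ⊥ ∧ J' ≠ ⊤ ∧
      IsAlgClosed (ResidueField S') := by
  have hιt0 : ι t ≠ 0 := fun h => ht0 (hιi (by rw [h, map_zero]))
  have hφt0 : φ t ≠ 0 := by
    rw [hφ]; exact fun h => hιt0 (hκi (by rw [h, map_zero]))
  have htnu : ¬ IsUnit (ι t) := fun h => hM.ne_top (Ideal.eq_top_of_isUnit_mem _ htM h)
  have hιm : ∀ x ∈ maximalIdeal S, ι x ∈ M₁ := by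
    intro x hx
    obtain ⟨x', hx'⟩ := hdiv x hx
    rw [← hx']; exact Ideal.mul_mem_left _ _ htM
  obtain ⟨y0, hy0⟩ : ∃ y0, maximalIdeal S = Ideal.span {t, y0} := by
    obtain ⟨a, b, hab⟩ := hm2
    have ha : a ∈ maximalIdeal S := by rw [hab]; exact Ideal.subset_span (by simp)
    have hb : b ∈ maximalIdeal S := by rw [hab]; exact Ideal.subset_span (by simp)
    have htm' := htm
    rw [hab] at htm'
    obtain ⟨α, β, hαβ⟩ := Ideal.mem_span_pair.1 htm'
    by_cases hα : IsUnit α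
    · refine ⟨b, le_antisymm ?_ ?_⟩
      · rw [hab, Ideal.span_le]
        obtain ⟨γ, hγ⟩ := hα.exists_left_inv
        rintro x (rfl | rfl)
        · exact Ideal.mem_span_pair.2 ⟨γ, -(γ * β), by
            rw [← hαβ]; linear_combination x * hγ⟩
        · exact Ideal.subset_span (by simp)
      · rw [Ideal.span_le]
        rintro x (rfl | rfl)
        · exact htm
        · exact hb
    by_cases hβ : IsUnit β
    · refine ⟨a, le_antisymm ?_ ?_⟩
      · rw [hab, Ideal.span_le]
        obtain ⟨γ, hγ⟩ := hβ.exists_left_inv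
        rintro x (rfl | rfl)
        · exact Ideal.subset_span (by simp)
        · exact Ideal.mem_span_pair.2 ⟨γ, -(γ * α), by
            rw [← hαβ]; linear_combination x * hγ⟩
      · rw [Ideal.span_le]
        rintro x (rfl | rfl)
        · exact htm
        · exact ha
    exfalso
    obtain ⟨a', ha'⟩ := hdiv a ha
    obtain ⟨b', hb'⟩ := hdiv b hb
    obtain ⟨α', hα'⟩ := hdiv α ((mem_maximalIdeal _).2 hα)
    obtain ⟨β', hβ'⟩ := hdiv β ((mem_maximalIdeal _).2 hβ)
    apply htnu
    have h1 : ι t * (ι t * (α' * a' + β' * b')) = ι t * 1 := by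
      have := congrArg ι hαβ
      rw [map_add, map_mul, map_mul, ← ha', ← hb', ← hα', ← hβ'] at this
      linear_combination this
    exact IsUnit.of_mul_eq_one _ (mul_left_cancel₀ hιt0 h1)
  have hy0m : y0 ∈ maximalIdeal S := by rw [hy0]; exact Ideal.subset_span (by simp)
  obtain ⟨y, hy⟩ := hdiv y0 hy0m
  have hgen' := hgen y0 hy0 y hy
  obtain ⟨s, hs⟩ := chart_point ι M₁ hM hιm y hgen'
  set z := y0 - s * t with hzdef
  set zB := y - ι s with hzB
  have hz : maximalIdeal S = Ideal.span {t, z} := by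
    rw [hy0]
    apply le_antisymm
    · rw [Ideal.span_le]
      rintro x (rfl | rfl)
      · exact Ideal.subset_span (by simp)
      · exact Ideal.mem_span_pair.2 ⟨s, 1, by rw [hzdef]; ring⟩
    · rw [Ideal.span_le]
      rintro x (rfl | rfl)
      · exact Ideal.subset_span (by simp)
      · exact Ideal.mem_span_pair.2 ⟨-s, 1, by rw [hzdef]; ring⟩
  have hzz : ι z = ι t * zB := by
    rw [hzdef, hzB, map_sub, map_mul, ← hy]; ring
  have hdec : ∀ g : B, ∃ (c : S) (h : B), g = ι c + zB * h := by
    intro g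
    obtain ⟨p, rfl⟩ := hgen' g
    obtain ⟨h, hh⟩ := Polynomial.sub_dvd_eval_sub y (ι s) (p.map ι)
    refine ⟨p.eval s, h, ?_⟩
    rw [Polynomial.eval_map, Polynomial.eval_map, Polynomial.eval₂_at_apply] at hh
    linear_combination hh
  have hιM : ∀ c, ι c ∈ M₁ → c ∈ maximalIdeal S := by
    intro c hc
    rw [mem_maximalIdeal]
    intro hu
    exact hM.ne_top (Ideal.eq_top_of_isUnit_mem _ hc (hu.map ι))
  have hM1 : ∀ g ∈ M₁, g ∈ Ideal.span {ι t, zB} := by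
    intro g hg
    obtain ⟨c, h, rfl⟩ := hdec g
    have hc : c ∈ maximalIdeal S := by
      apply hιM
      have := M₁.sub_mem hg (Ideal.mul_mem_right h _ hs)
      simpa using this
    obtain ⟨c', hc'⟩ := hdiv c hc
    exact Ideal.mem_span_pair.2 ⟨c', h, by rw [hc']; ring⟩
  have hκM : ∀ g ∈ M₁, κ g ∈ maximalIdeal S' := by
    intro g hg
    rw [mem_maximalIdeal]
    intro hu
    obtain ⟨y', hy'⟩ := hu.exists_right_inv
    obtain ⟨a, b, hb, hab⟩ := hloc2 y'
    apply hb
    have : b = g * a := by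
      apply hκi
      rw [map_mul, ← hab, ← mul_assoc, hy', one_mul]
    rw [this]
    exact Ideal.mul_mem_right _ _ hg
  have hm' : maximalIdeal S' = Ideal.span {φ t, κ zB} := by
    apply le_antisymm
    · intro y' hy'
      obtain ⟨a, b, hb, hab⟩ := hloc2 y'
      have ha : a ∈ M₁ := by
        by_contra ha
        have h1 := hloc1 a ha
        rw [← hab] at h1
        exact (mem_maximalIdeal _).1 hy' (isUnit_of_mul_isUnit_left h1)
      have h2 : y' * κ b ∈ Ideal.span {φ t, κ zB} := by
        rw [hab, hφ]
        obtain ⟨e, f, hef⟩ := Ideal.mem_span_pair.1 (hM1 a ha)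
        exact Ideal.mem_span_pair.2 ⟨κ e, κ f, by rw [← hef]; simp⟩
      exact (Ideal.mul_unit_mem_iff_mem _ (hloc1 b hb)).1 h2
    · rw [Ideal.span_le]
      rintro x (rfl | rfl)
      · rw [hφ]; exact hκM _ htM
      · exact hκM _ hs
  have hdivr : ∀ f ∈ J, ∃ f' : B, f' * ι t ^ r = ι f := by
    intro f hf
    have h1 : (maximalIdeal S).map ι ≤ Ideal.span {ι t} := by
      rw [Ideal.map_le_iff_le_comap]
      intro x hx
      obtain ⟨x', hx'⟩ := hdiv x hx
      rw [Ideal.mem_comap, Ideal.mem_span_singleton]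
      exact ⟨x', by rw [← hx']; ring⟩
    have h2 : ι f ∈ (maximalIdeal S ^ r).map ι := Ideal.mem_map_of_mem _ (hr hf)
    rw [Ideal.map_pow] at h2
    have h3 := Ideal.pow_right_mono h1 r h2
    rw [Ideal.span_singleton_pow, Ideal.mem_span_singleton] at h3
    obtain ⟨f', hf'⟩ := h3
    exact ⟨f', by rw [hf']; ring⟩
  have hcan : ∀ c c' : B, c * ι t ^ r = c' * ι t ^ r → c = c' := fun c c' h =>
    mul_right_cancel₀ (pow_ne_zero r hιt0) h
  have hcan' : ∀ c c' : S', c * φ t ^ r = c' * φ t ^ r → c = c' := fun c c' h =>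
    mul_right_cancel₀ (pow_ne_zero r hφt0) h
  have hdivJ : ∀ f ∈ J, ∃ f' ∈ C, κ f' * φ t ^ r = φ f := by
    intro f hf
    obtain ⟨f', hf'⟩ := hdivr f hf
    refine ⟨f', ?_, ?_⟩
    · rw [hC, hf']; exact Ideal.mem_map_of_mem _ hf
    · rw [hφ, hφ, ← hf']; simp
  refine ⟨⟨z, κ zB, hz, hm', ?_, ?_⟩, ?_, ?_, ?_⟩
  · rw [hφ, hφ, hzz, map_mul]
  · rw [hJ']
    apply le_antisymm
    · rw [Ideal.map_le_iff_le_comap]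
      intro c hc
      rw [hC] at hc
      rw [Ideal.mem_comap]
      have key : ∀ b ∈ J.map ι, ∃ c, c * ι t ^ r = b ∧
          κ c ∈ Ideal.span {g | ∃ f ∈ J, g * φ t ^ r = φ f} := by
        intro b hb
        refine Submodule.span_induction ?_ ?_ ?_ ?_ hb
        · rintro _ ⟨f, hf, rfl⟩
          obtain ⟨f', hf'⟩ := hdivr f hf
          refine ⟨f', hf', Ideal.subset_span ⟨f, hf, ?_⟩⟩
          rw [hφ, hφ, ← hf']; simp
        · exact ⟨0, by simp, by simp⟩
        · rintro _ _ - - ⟨c1, rfl, h1⟩ ⟨c2, rfl, h2⟩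
          exact ⟨c1 + c2, by ring, by rw [map_add]; exact add_mem h1 h2⟩
        · rintro a _ - ⟨c1, rfl, h1⟩
          exact ⟨a * c1, by rw [smul_eq_mul]; ring, by rw [map_mul]; exact Ideal.mul_mem_left _ _ h1⟩
      obtain ⟨c', hc', hc2⟩ := key _ hc
      rwa [hcan _ _ hc'] at hc2
    · rw [Ideal.span_le]
      rintro g ⟨f, hf, hg⟩
      obtain ⟨f', hf', hf2⟩ := hdivJ f hf
      rw [hcan' g (κ f') (by rw [hg, hf2])]
      exact Ideal.mem_map_of_mem _ hf'
  · obtain ⟨f, hf, hf0⟩ := Submodule.exists_mem_ne_zero_of_ne_bot hJ0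
    obtain ⟨f', hf', hf2⟩ := hdivJ f hf
    intro hb
    have : κ f' ∈ J' := by rw [hJ']; exact Ideal.mem_map_of_mem _ hf'
    rw [hb, Ideal.mem_bot] at this
    rw [this, zero_mul, hφ] at hf2
    apply hf0
    apply hιi
    apply hκi
    rw [← hf2, map_zero, map_zero]
  · have : J' ≤ maximalIdeal S' := by
      rw [hJ', Ideal.map_le_iff_le_comap]
      exact fun c hc => hκM c (hCM hc)
    intro h
    rw [h] at this
    exact Ideal.IsPrime.ne_top' (top_le_iff.1 this)
  · refine algClosed_transfer φ (fun x hx => by rw [hφ]; exact hκM _ (hιm x hx)) ?_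
    intro y'
    obtain ⟨a, b, hb, hab⟩ := hloc2 y'
    obtain ⟨c, h, hch⟩ := hdec a
    obtain ⟨c0, h0, hch0⟩ := hdec b
    have hu : IsUnit c0 := by
      by_contra hn
      apply hb
      rw [hch0]
      exact add_mem (hιm _ ((mem_maximalIdeal _).2 hn)) (Ideal.mul_mem_right _ _ hs)
    obtain ⟨e, he⟩ := hu.exists_right_inv
    refine ⟨c * e, (Ideal.mul_unit_mem_iff_mem _ (hloc1 b hb)).1 ?_⟩
    have : (y' - φ (c * e)) * κ b = κ (zB * (h - h0 * ι (c * e))) := by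
      rw [sub_mul, hab, hφ, ← map_mul, ← map_sub]
      congr 1
      have he' : ι c0 * ι e = 1 := by rw [← map_mul, he, map_one]
      rw [hch, hch0, map_mul]
      linear_combination (-ι c) * he'
    rw [this]
    exact hκM _ (Ideal.mul_mem_right _ _ hs)

theorem step_data {R : Type u} [CommRing R] [IsDomain R]
    (S S' : Subalgebra R (FractionRing R)) [IsLocalRing S] [IsLocalRing S']
    [IsAlgClosed (ResidueField S)] (hSS' : S ≤ S')
    (hm2 : ∃ a b, maximalIdeal S = Ideal.span {a, b})
    (J : Ideal S) (J' : Ideal S') (hJ0 : J ≠ ⊥)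
    (hpow : ∀ x ∈ maximalIdeal S, ∃ N, x ^ N ∈ J)
    (h : IsQuadraticTransformStep S S' J J') :
    (∃ (t z : S) (z' : S') (r : ℕ), maximalIdeal S = Ideal.span {t, z} ∧
      maximalIdeal S' = Ideal.span {Subalgebra.inclusion hSS' t, z'} ∧
      Subalgebra.inclusion hSS' z = Subalgebra.inclusion hSS' t * z' ∧
      J ≤ maximalIdeal S ^ r ∧ ¬ J ≤ maximalIdeal S ^ (r + 1) ∧
      J' = Ideal.span {g | ∃ f ∈ J, g * Subalgebra.inclusion hSS' t ^ r =
        Subalgebra.inclusion hSS' f}) ∧ J' ≠ ⊥ ∧ J' ≠ ⊤ ∧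
      IsAlgClosed (ResidueField S') := by
  obtain ⟨t, r, hSc, hcS', htm, hr, hr', M₁, hM, hCM, -, hS', hJ'⟩ := h
  rw [maxIdealOf_eq] at htm hr hr'
  set C := (Ideal.map (Subalgebra.inclusion hSc) J).colon
    (Ideal.span {Subalgebra.inclusion hSc t ^ r} : Ideal (chartOf S t)) with hCdef
  have hC : ∀ c, c ∈ C ↔ c * Subalgebra.inclusion hSc t ^ r ∈
      J.map (Subalgebra.inclusion hSc : S →+* chartOf S t) := by
    intro c
    rw [hCdef, Submodule.mem_colon]
    constructor
    · intro h
      exact h _ (Ideal.subset_span rfl)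
    · intro h s hs
      obtain ⟨e, rfl⟩ := Ideal.mem_span_singleton.1 hs
      rw [smul_eq_mul, ← mul_assoc]
      exact Ideal.mul_mem_right _ _ h
  have hJC : ∀ f ∈ J, Subalgebra.inclusion hSc f ∈ M₁ := by
    intro f hf
    apply hCM
    rw [hC]
    exact Ideal.mul_mem_right _ _ (Ideal.mem_map_of_mem _ hf)
  have ht0 : t ≠ 0 := by
    rintro rfl
    obtain ⟨f, hf, hf0⟩ := Submodule.exists_mem_ne_zero_of_ne_bot hJ0
    have hf1 := hJC f hf
    have hf0' : (f : FractionRing R) ≠ 0 := fun h => hf0 (Subtype.ext h)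
    have hinv : (f : FractionRing R)⁻¹ ∈ chartOf S 0 :=
      Algebra.subset_adjoin (Or.inr ⟨0, zero_mem _, by simp⟩)
    apply hM.ne_top
    apply Ideal.eq_top_of_isUnit_mem _ hf1
    exact IsUnit.of_mul_eq_one ⟨_, hinv⟩ (Subtype.ext (mul_inv_cancel₀ hf0'))
  have ht0' : (t : FractionRing R) ≠ 0 := fun h => ht0 (Subtype.ext h)
  have htM : Subalgebra.inclusion hSc t ∈ M₁ := by
    obtain ⟨N, hN⟩ := hpow t htm
    have := hJC _ hN
    rw [map_pow] at this
    exact hM.isPrime.mem_of_pow_mem _ this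
  have hunit : ∀ b : chartOf S t, b ∉ M₁ → IsUnit (Subalgebra.inclusion hcS' b) := by
    intro b hb
    have hb0 : (b : FractionRing R) ≠ 0 := by
      intro h
      apply hb
      rw [show b = 0 from Subtype.ext h]
      exact zero_mem _
    have hinv : (b : FractionRing R)⁻¹ ∈ (S' : Set (FractionRing R)) := by
      rw [hS']
      exact ⟨1, b, hb, by simp [inv_mul_cancel₀ hb0]⟩
    exact IsUnit.of_mul_eq_one ⟨_, hinv⟩ (Subtype.ext (mul_inv_cancel₀ hb0))
  have hmain := chart_abs (S := S) (B := chartOf S t) (S' := S')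
    (Subalgebra.inclusion hSc : S →+* chartOf S t) (Subalgebra.inclusion hcS' : chartOf S t →+* S')
    (Subalgebra.inclusion hSS' : S →+* S') (fun s => rfl)
    (Subalgebra.inclusion_injective hSc) (Subalgebra.inclusion_injective hcS')
    t ht0 M₁ hM htM htm ?_ hm2 ?_ hunit ?_ J J' r hJ0 hr C hC hCM hJ'
  · obtain ⟨⟨z, z', h1, h2, h3, h4⟩, h5⟩ := hmain
    exact ⟨⟨t, z, z', r, h1, h2, h3, hr, hr', h4⟩, h5⟩
  · intro y hy
    refine ⟨⟨(y : FractionRing R) / t, Algebra.subset_adjoin (Or.inr ⟨y, ?_, ?_⟩)⟩, ?_⟩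
    · rw [maxIdealOf_eq]; exact hy
    · exact div_mul_cancel₀ _ ht0'
    · exact Subtype.ext (div_mul_cancel₀ _ ht0')
  · intro y0 hy0 y hy g
    have hyK : (y : FractionRing R) * t = y0 := congrArg Subtype.val hy
    have key : ∀ g ∈ chartOf S t, ∃ p : Polynomial S,
        g = p.eval₂ (algebraMap S (FractionRing R)) (y : FractionRing R) := by
      intro g hg
      refine Algebra.adjoin_induction (p := fun g _ => ∃ p : Polynomial S,
        g = p.eval₂ (algebraMap S (FractionRing R)) (y : FractionRing R)) ?_ ?_ ?_ ?_ hg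
      · rintro x (hx | ⟨y1, hy1, hx⟩)
        · exact ⟨Polynomial.C ⟨x, hx⟩, by rw [Polynomial.eval₂_C]; rfl⟩
        · rw [maxIdealOf_eq, hy0] at hy1
          obtain ⟨α, β, hαβ⟩ := Ideal.mem_span_pair.1 hy1
          refine ⟨Polynomial.C α + Polynomial.C β * Polynomial.X, ?_⟩
          rw [Polynomial.eval₂_add, Polynomial.eval₂_mul, Polynomial.eval₂_C, Polynomial.eval₂_C,
            Polynomial.eval₂_X]
          apply mul_right_cancel₀ ht0'
          rw [hx, ← hαβ]
          change (α : FractionRing R) * t + β * y0 = ((α : FractionRing R) + β * y) * t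
          rw [← hyK]; ring
      · intro a
        exact ⟨Polynomial.C (algebraMap R S a), by rw [Polynomial.eval₂_C]; rfl⟩
      · rintro _ _ - - ⟨p, rfl⟩ ⟨q, rfl⟩
        exact ⟨p + q, by rw [Polynomial.eval₂_add]⟩
      · rintro _ _ - - ⟨p, rfl⟩ ⟨q, rfl⟩
        exact ⟨p * q, by rw [Polynomial.eval₂_mul]⟩
    obtain ⟨p, hp⟩ := key g g.2
    refine ⟨p, Subtype.ext ?_⟩
    rw [hp]
    exact (Polynomial.hom_eval₂ p (Subalgebra.inclusion hSc : S →+* chartOf S t)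
      ((chartOf S t).val : chartOf S t →+* FractionRing R) y).symm
  · intro y
    have : (y : FractionRing R) ∈ (S' : Set (FractionRing R)) := y.2
    rw [hS'] at this
    obtain ⟨a, b, hb, hab⟩ := this
    exact ⟨a, b, hb, Subtype.ext hab⟩

end DegAux


/-- Let `(R, M)` be a two-dimensional regular local ring with algebraically closed residue
field, let `I` be a simple complete `M`-primary ideal with unique Rees valuation `w`, and
let `(R, M) < (R₁, M₁) < ⋯ < (R_s, M_s)` be the unique quadratic sequence determined by
`I`, so that the successive transforms satisfy `I^{R_s} = M_s` and `w` is the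
`ord_{R_s}`-valuation.  Then the degree function coefficients satisfy
`d(I, w) = d(I^{R₁}, w) = ⋯ = d(I^{R_s}, w) = d(M_s, ord_{R_s})`. -/
theorem degree_coeffs_constant_along_quadratic_sequence
    (R : Type*) [CommRing R] [IsLocalRing R] [IsNoetherianRing R] [IsDomain R]
    (hdim : ringKrullDim R = 2)
    (hreg : ∃ x y : R, maximalIdeal R = Ideal.span {x, y})
    [IsAlgClosed (ResidueField R)]
    (I : Ideal R) (hIc : I.IsComplete) (hIs : I.IsSimpleIdeal) (hIp : I.IsMPrimary)
    (s : ℕ)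
    -- the quadratic sequence `R = R₀ < R₁ < ⋯ < R_s` inside the fraction field of `R`
    (A : Fin (s + 1) → Subalgebra R (FractionRing R))
    (hA0 : A 0 = ⊥)
    (hmono : ∀ i : Fin s, A i.castSucc ≤ A i.succ)
    (hlocal : ∀ i, IsNoetherianRing ↥(A i) ∧ IsLocalRing ↥(A i) ∧
      ringKrullDim ↥(A i) = 2 ∧ ∃ a b : ↥(A i), maxIdealOf ↥(A i) = Ideal.span {a, b})
    -- the successive transforms `I^{R_i}` of `I`
    (J : ∀ i, Ideal ↥(A i))
    (hJ0 : J 0 = Ideal.map (algebraMap R ↥(A 0)) I)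
    (hstep : ∀ i : Fin s, IsQuadraticTransformStep (A i.castSucc) (A i.succ)
      (J i.castSucc) (J i.succ))
    (hlast : J (Fin.last s) = maxIdealOf ↥(A (Fin.last s)))
    -- the valuation `w`, realized compatibly on each ring of the sequence
    (w : ∀ i, DiscreteValuationOn ↥(A i))
    (hw : ∀ (i : Fin s) (a : ↥(A i.castSucc)),
      (w i.succ).v (Subalgebra.inclusion (hmono i) a) = (w i.castSucc).v a)
    -- `w` is the unique Rees valuation of each transform `I^{R_i}`
    (hRees : ∀ i, IsReesValuationsOf (J i) {w i})
    -- `w` is the `ord_{R_s}`-valuation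
    (hord : ∀ (n : ℕ) (a : ↥(A (Fin.last s))),
      (n : ℕ∞) ≤ (w (Fin.last s)).v a ↔ a ∈ maxIdealOf ↥(A (Fin.last s)) ^ n)
    -- the degree function coefficients `d i = d(I^{R_i}, w)`
    (d : Fin (s + 1) → ℕ)
    (hd : ∀ i, IsDegreeCoeffFor (J i) (w i) (d i)) :
    ∀ i, d i = d (Fin.last s) := by
  have hkey : ∀ i : Fin (s + 1), (∃ _ : IsLocalRing (A i), IsAlgClosed (ResidueField (A i))) ∧
      J i ≠ ⊥ := by
    intro i
    induction i using Fin.induction with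
    | zero =>
      have hl := (hlocal 0).2.1
      have hbij : Function.Bijective (algebraMap R (A 0)) := by
        constructor
        · intro a b hab
          have h1 := congrArg Subtype.val hab
          exact IsFractionRing.injective R (FractionRing R) h1
        · rintro ⟨x, hx⟩
          rw [hA0] at hx
          obtain ⟨a, ha⟩ := Algebra.mem_bot.1 hx
          exact ⟨a, Subtype.ext ha⟩
      refine ⟨⟨hl, ?_⟩, ?_⟩
      · refine DegAux.algClosed_transfer (algebraMap R (A 0)) ?_ ?_
        · intro x hx
          rw [mem_maximalIdeal] at hx ⊢
          intro hu
          apply hx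
          exact (MulEquiv.isUnit_map (RingEquiv.ofBijective (algebraMap R (A 0)) hbij)).1 hu
        · intro y
          obtain ⟨x, rfl⟩ := hbij.2 y
          exact ⟨x, by simp⟩
      · rw [hJ0]
        intro hb
        rw [Ideal.map_eq_bot_iff_of_injective hbij.1] at hb
        rw [Ideal.IsMPrimary, hb] at hIp
        have h0 : maximalIdeal R = ⊥ := by
          rw [← hIp]
          exact (Ideal.isPrime_bot (α := R)).radical
        have hf := IsLocalRing.isField_iff_maximalIdeal_eq.2 h0
        rw [ringKrullDim_eq_zero_of_isField hf] at hdim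
        exact absurd hdim (by decide)
    | succ i ih =>
      obtain ⟨⟨hl, hac⟩, hb⟩ := ih
      obtain ⟨hN, -, hd2, hm2⟩ := hlocal i.castSucc
      obtain ⟨hN', hl', hd2', hm2'⟩ := hlocal i.succ
      rw [DegAux.maxIdealOf_eq] at hm2
      obtain ⟨-, h1, -, h3⟩ := DegAux.step_data _ _ (hmono i) hm2 _ _ hb
        (DegAux.pow_mem_of_deg _ _ _ (hd _) hb) (hstep i)
      exact ⟨⟨hl', h3⟩, h1⟩
  have hone : ∀ i : Fin s, d i.castSucc = d i.succ := by
    intro i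
    obtain ⟨⟨hl, hac⟩, hb⟩ := hkey i.castSucc
    obtain ⟨hN, -, hd2, hm2⟩ := hlocal i.castSucc
    obtain ⟨hN', hl', hd2', hm2'⟩ := hlocal i.succ
    rw [DegAux.maxIdealOf_eq] at hm2
    obtain ⟨⟨t, z, z', r, h1, h2, h3, h4, h5, h6⟩, h7, h8, -⟩ := DegAux.step_data _ _ (hmono i)
      hm2 _ _ hb (DegAux.pow_mem_of_deg _ _ _ (hd _) hb) (hstep i)
    have : Infinite (ResidueField (A i.castSucc)) := IsAlgClosed.instInfinite
    exact DegAux.core hd2 hd2' (Subalgebra.inclusion (hmono i) : A i.castSucc →+* A i.succ)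
      t z z' h1 h2 h3 _ _ r h4 h5 h6 hb h7 h8 _ _ (hw i) (hRees _) _ _ (hd _) (hd _)
  intro i
  induction i using Fin.reverseInduction with
  | last => rfl
  | cast i ih => rw [hone i, ih]
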